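/- Let D = (V,A) be a digraph, E, T ⊆ V, c a cycle in D, x,t ∉ V distinct new vertices, and D' = D^{(c)}_{(x,t)} the lifting of c in D by (x,t). Then for every X ⊆ E, there exists a routing X ⇉ T in D if and only if there exists a routing X∪{x} ⇉ T∪{t} in D'. -/

import Mathlib

/-- A walk in the digraph with arc set `A`: a nonempty list of vertices,
each consecutive pair of which is an arc. -/
def IsWalk {V : Type*} (A : Set (V × V)) (p : List V) : Prop :=
  p ≠ [] ∧ p.Chain' (fun u v => (u, v) ∈ A)

/-- A path: a walk with pairwise distinct vertices. -/
def IsPath {V : Type*} (A : Set (V × V)) (p : List V) : Prop :=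
  IsWalk A p ∧ p.Nodup

/-- The set of arcs traversed by a walk. -/
def pathArcs {V : Type*} (p : List V) : Set (V × V) :=
  {a | a ∈ p.zip p.tail}

/-- A cycle: a walk `c₁…c_n` with `n > 1`, `c₁ = c_n`, and `c₁…c_{n-1}` a path. -/
def IsCycle {V : Type*} (A : Set (V × V)) (p : List V) : Prop :=
  IsWalk A p ∧ 1 < p.length ∧ p.head? = p.getLast? ∧ IsPath A p.dropLast

/-- A routing from `X` to `Y`: a set of pairwise vertex-disjoint paths such that
every `x ∈ X` is the first vertex of some path and every path ends in `Y`. -/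
def IsRouting {V : Type*} (A : Set (V × V)) (R : Set (List V)) (X Y : Set V) : Prop :=
  (∀ p ∈ R, IsPath A p) ∧
  (∀ x ∈ X, ∃ p ∈ R, p.head? = some x) ∧
  (∀ p ∈ R, ∃ y ∈ Y, p.getLast? = some y) ∧
  (∀ p ∈ R, ∀ q ∈ R, p = q ∨ ∀ v, v ∈ p → v ∉ q)

/-- There is a routing from `X` to `Y` in the digraph with arcs `A`. -/
def HasRouting {V : Type*} (A : Set (V × V)) (X Y : Set V) : Prop :=
  ∃ R, IsRouting A R X Y

/-- A linking from `X` onto `Y`: a routing whose set of path endpoints is exactly `Y`. -/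
def IsLinking {V : Type*} (A : Set (V × V)) (R : Set (List V)) (X Y : Set V) : Prop :=
  IsRouting A R X Y ∧ {y | ∃ p ∈ R, p.getLast? = some y} = Y

/-- Independence in the gammoid `Γ(D,T,E)`. -/
def GammoidIndep {V : Type*} (A : Set (V × V)) (T E : Set V) (X : Set V) : Prop :=
  X ⊆ E ∧ HasRouting A X T

/-- Circuits of the gammoid `Γ(D,T,E)`: minimal dependent subsets of `E`. -/
def GammoidCircuit {V : Type*} (A : Set (V × V)) (T E : Set V) (C : Set V) : Prop :=
  C ⊆ E ∧ ¬HasRouting A C T ∧ ∀ C', C' ⊂ C → HasRouting A C' T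

/-- Independence in the contraction `M/C` of a matroid given by its independence
predicate: `X` is independent iff `X ∪ I` is independent for some maximal
independent subset `I` of `C`. -/
def ContractIndep {α : Type*} (Indep : Set α → Prop) (C : Set α) (X : Set α) : Prop :=
  ∃ I, I ⊆ C ∧ Indep I ∧ (∀ J, I ⊆ J → J ⊆ C → Indep J → J = I) ∧ Indep (X ∪ I)

/-- An indeterminate weighting: an injective map on arcs whose values cannot be expressed
as integer polynomial expressions (`a₀ + a₁·x₁₁⋯x₁ₙ + …`) in the remaining values. -/
def IsIndetWeighting {V : Type*} (A : Set (V × V)) (w : V × V → ℝ) : Prop :=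
  Set.InjOn w A ∧ ∀ a ∈ A, w a ∉ Subring.closure (w '' A \ {w a})

/-- The product of the weights of the arcs traversed by a walk. -/
def pathProd {V : Type*} (w : V × V → ℝ) (p : List V) : ℝ :=
  ((p.zip p.tail).map w).prod

/-- The path matrix: `μ(u,v)` is the sum over all paths from `u` to `v`
of the product of the arc weights. -/
noncomputable def pathMatrix {V : Type*} (A : Set (V × V)) (w : V × V → ℝ) (u v : V) : ℝ :=
  ∑ᶠ p ∈ {p : List V | IsPath A p ∧ p.head? = some u ∧ p.getLast? = some v}, pathProd w p

/-- `r` is a linear order on the elements of `A`. -/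
def IsLinearOrderOn {β : Type*} (A : Set β) (r : β → β → Prop) : Prop :=
  (∀ a ∈ A, r a a) ∧ (∀ a ∈ A, ∀ b ∈ A, r a b → r b a → a = b) ∧
  (∀ a ∈ A, ∀ b ∈ A, ∀ c ∈ A, r a b → r b c → r a c) ∧
  (∀ a ∈ A, ∀ b ∈ A, r a b ∨ r b a)

/-- The set of arcs traversed by a routing. -/
def routingArcs {V : Type*} (R : Set (List V)) : Set (V × V) :=
  ⋃ p ∈ R, pathArcs p

/-- The `(σ,≪)`-induced routing order: `Q ≪≪ R` iff the `≪`-maximal element of the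
symmetric difference `Q_A △ R_A` lies in `R_A`. -/
def RoutingLT {V : Type*} (r : V × V → V × V → Prop) (Q R : Set (List V)) : Prop :=
  ∃ a ∈ routingArcs R, a ∈ symmDiff (routingArcs Q) (routingArcs R) ∧
    ∀ b ∈ symmDiff (routingArcs Q) (routingArcs R), r b a

/-- `R` is the `≪≪`-maximal routing from `X` to `Y`. -/
def IsMaxRouting {V : Type*} (r : V × V → V × V → Prop) (A : Set (V × V))
    (R : Set (List V)) (X Y : Set V) : Prop :=
  IsRouting A R X Y ∧ ∀ Q, IsRouting A Q X Y → Q ≠ R → RoutingLT r Q R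

/-- A `(σ,≪)`-weighting: an indeterminate weighting with `|w(a)| ≥ 1`,
`sgn(w(a)) = σ(a)`, and `Σ_{L ⊆ {x ≪ a, x ≠ a}} Π_{x∈L} |w(x)| < |w(a)|` for all arcs. -/
def IsHeavyWeighting {V : Type*} (A : Set (V × V)) (σ : V × V → ℝ)
    (r : V × V → V × V → Prop) (w : V × V → ℝ) : Prop :=
  IsIndetWeighting A w ∧ ∀ a ∈ A,
    1 ≤ |w a| ∧ Real.sign (w a) = σ a ∧
    (∑ᶠ L ∈ {L : Set (V × V) | L ⊆ {x ∈ A | r x a ∧ x ≠ a}}, ∏ᶠ x ∈ L, |w x|) < |w a|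

/-- The arc set of the lifting `D^{(c)}_{(x,t)}` of a cycle `c = u v …` in `D`. -/
def liftArcs {V : Type*} (A : Set (V × V)) (u v x t : V) : Set (V × V) :=
  (A \ {(u, v)}) ∪ {(u, t), (x, v), (x, t)}

theorem isPath_iff {V : Type*} {A : Set (V × V)} {p : List V} :
    IsPath A p ↔ p ≠ [] ∧ p.IsChain (fun a b => (a, b) ∈ A) ∧ p.Nodup :=
  and_assoc

theorem IsPath.of_mem_imp {V : Type*} {A B : Set (V × V)} {p : List V} (hp : IsPath A p)
    (h : ∀ a ∈ p, ∀ b ∈ p, (a, b) ∈ A → (a, b) ∈ B) : IsPath B p := by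
  rw [isPath_iff] at hp ⊢
  exact ⟨hp.1, hp.2.1.imp_of_mem_imp fun a b ha hb => h a ha b hb, hp.2.2⟩

/-- The vertices of a path ending in `W` lie in `W`, if all arcs start in `W`. -/
theorem IsPath.subset_of_getLast? {V : Type*} {A : Set (V × V)} {W : Set V} {p : List V}
    (hp : IsPath A p) (hA : ∀ a ∈ A, a.1 ∈ W) (hl : ∃ y ∈ W, p.getLast? = some y) :
    ∀ w ∈ p, w ∈ W := by
  intro w hw
  obtain ⟨a, b, rfl⟩ := List.append_of_mem hw
  obtain ⟨y, hy, hl⟩ := hl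
  rw [isPath_iff] at hp
  cases b with
  | nil =>
    simp only [List.getLast?_append, List.getLast?_singleton, Option.some_or,
      Option.some.injEq] at hl
    exact hl ▸ hy
  | cons c b => exact hA _ (List.isChain_append_cons_cons.mp hp.2.1).2.1

/-- A sink occurs on a path only as its last vertex. -/
theorem IsPath.eq_append_singleton {V : Type*} {A : Set (V × V)} {p : List V} {t : V}
    (hp : IsPath A p) (hA : ∀ a, (t, a) ∉ A) (ht : t ∈ p) : ∃ q, p = q ++ [t] := by
  obtain ⟨a, b, rfl⟩ := List.append_of_mem ht
  rw [isPath_iff] at hp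
  cases b with
  | nil => exact ⟨a, rfl⟩
  | cons c b => exact absurd (List.isChain_append_cons_cons.mp hp.2.1).2.1 (hA c)

theorem IsRouting.mono {V : Type*} {A : Set (V × V)} {R : Set (List V)} {X X' Y Y' : Set V}
    (h : IsRouting A R X Y) (hX : X' ⊆ X) (hY : Y ⊆ Y') : IsRouting A R X' Y' :=
  ⟨h.1, fun a ha => h.2.1 a (hX ha),
    fun p hp => let ⟨y, hy, e⟩ := h.2.2.1 p hp; ⟨y, hY hy, e⟩, h.2.2.2⟩

theorem IsRouting.insert_path {V : Type*} {A : Set (V × V)} {R : Set (List V)} {X Y : Set V}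
    {p : List V} {a : V} (h : IsRouting A R X Y) (hp : IsPath A p) (ha : p.head? = some a)
    (hl : ∃ y ∈ Y, p.getLast? = some y) (hd : ∀ q ∈ R, ∀ w ∈ p, w ∉ q) :
    IsRouting A (insert p R) (insert a X) Y := by
  refine ⟨?_, ?_, ?_, ?_⟩
  · rintro q (rfl | hq)
    exacts [hp, h.1 q hq]
  · rintro b (rfl | hb)
    · exact ⟨p, .inl rfl, ha⟩
    · obtain ⟨q, hq, e⟩ := h.2.1 b hb
      exact ⟨q, .inr hq, e⟩
  · rintro q (rfl | hq)
    exacts [hl, h.2.2.1 q hq]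
  · rintro q (rfl | hq) r (rfl | hr)
    · exact .inl rfl
    · exact .inr (hd r hr)
    · exact .inr fun w hw hw' => hd q hq w hw' hw
    · exact h.2.2.2 q hq r hr

theorem HasRouting.to_liftArcs {V : Type*} {A : Set (V × V)} {W X T : Set V} {u v x t : V}
    (hA : ∀ a ∈ A, a.1 ∈ W ∧ a.2 ∈ W) (hT : T ⊆ W) (hx : x ∉ W) (ht : t ∉ W) (hxt : x ≠ t)
    (h : HasRouting A X T) : HasRouting (liftArcs A u v x t) (X ∪ {x}) (T ∪ {t}) := by
  obtain ⟨R, hR⟩ := h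
  have hW : ∀ p ∈ R, ∀ w ∈ p, w ∈ W := fun p hp =>
    (hR.1 p hp).subset_of_getLast? (fun a ha => (hA a ha).1)
      (let ⟨y, hy, e⟩ := hR.2.2.1 p hp; ⟨y, hT hy, e⟩)
  by_cases hu : ∃ p ∈ R, ∃ a b, p = a ++ u :: v :: b
  · obtain ⟨p, hp, a, b, rfl⟩ := hu
    have hpp := isPath_iff.mp (hR.1 _ hp)
    have hpW := hW _ hp
    have hdis : ∀ q ∈ R, q ≠ a ++ u :: v :: b → ∀ w ∈ a ++ u :: v :: b, w ∉ q := by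
      intro q hq hne
      exact (hR.2.2.2 _ hp q hq).resolve_left (Ne.symm hne)
    obtain ⟨hc1, huv, hc2⟩ := List.isChain_append_cons_cons.mp hpp.2.1
    have hnd := hpp.2.2
    have h0 : IsRouting (liftArcs A u v x t) (R \ {a ++ u :: v :: b})
        {y ∈ X | (a ++ u :: v :: b).head? ≠ some y} (T ∪ {t}) := by
      refine ⟨?_, ?_, ?_, ?_⟩
      · rintro q ⟨hq, hne⟩
        refine (hR.1 q hq).of_mem_imp fun c hc d hd hcd => .inl ⟨hcd, ?_⟩
        rintro ⟨⟩
        exact hdis q hq hne u (by simp) hc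
      · rintro y ⟨hy, hne⟩
        obtain ⟨q, hq, e⟩ := hR.2.1 y hy
        refine ⟨q, ⟨hq, ?_⟩, e⟩
        rintro rfl
        exact hne e
      · rintro q ⟨hq, -⟩
        obtain ⟨y, hy, e⟩ := hR.2.2.1 q hq
        exact ⟨y, .inl hy, e⟩
      · rintro q ⟨hq, -⟩ r ⟨hr, -⟩
        exact hR.2.2.2 q hq r hr
    obtain ⟨y, hy⟩ : ∃ y, (a ++ u :: v :: b).head? = some y := by cases a <;> simp
    have hP1 : IsPath (liftArcs A u v x t) (a ++ [u, t]) := by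
      refine isPath_iff.mpr ⟨by simp, ?_, ?_⟩
      · refine List.isChain_append_cons_cons.mpr
          ⟨?_, .inr (.inl rfl), List.isChain_singleton _⟩
        refine hc1.imp_of_mem_imp fun c d hc hd hcd => .inl ⟨hcd, ?_⟩
        rintro ⟨⟩
        grind
      · have : t ∉ a ++ u :: v :: b := fun h => ht (hpW t h)
        grind
    have hP2 : IsPath (liftArcs A u v x t) (x :: v :: b) := by
      refine isPath_iff.mpr ⟨by simp, ?_, ?_⟩
      · refine List.isChain_cons_cons.mpr ⟨.inr (.inr (.inl rfl)), ?_⟩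
        refine hc2.imp_of_mem_imp fun c d hc hd hcd => .inl ⟨hcd, ?_⟩
        rintro ⟨⟩
        grind
      · have : x ∉ a ++ u :: v :: b := fun h => hx (hpW x h)
        grind
    have h1 := h0.insert_path hP1 (a := y) (by cases a <;> simpa using hy) ⟨t, by simp⟩ (by
      rintro q ⟨hq, hne⟩ w hw hwq
      have := hdis q hq hne w
      have : w ≠ t := fun e => ht (e ▸ hW q hq w hwq)
      grind)
    have h2 := h1.insert_path hP2 (a := x) rfl (by
        obtain ⟨z, hz, e⟩ := hR.2.2.1 _ hp
        refine ⟨z, .inl hz, ?_⟩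
        simpa [List.getLast?_append, List.getLast?_cons_cons] using e) (by
      have hpt : t ∉ a ++ u :: v :: b := fun h => ht (hpW t h)
      have hpx : x ∉ a ++ u :: v :: b := fun h => hx (hpW x h)
      rintro q (rfl | ⟨hq, hne⟩) w hw hwq
      · grind
      · have := hdis q hq hne w
        have : w ≠ x := fun e => hx (e ▸ hW q hq w hwq)
        grind)
    refine ⟨_, h2.mono ?_ subset_rfl⟩
    rintro z (hz | rfl)
    · by_cases e : z = y
      · exact .inr (.inl e)
      · exact .inr (.inr ⟨hz, by rw [hy]; simpa using Ne.symm e⟩)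
    · exact .inl rfl
  · have h0 : IsRouting (liftArcs A u v x t) R X (T ∪ {t}) := by
      refine IsRouting.mono ⟨fun p hp => ?_, hR.2⟩ subset_rfl Set.subset_union_left
      have hpp := isPath_iff.mp (hR.1 p hp)
      refine isPath_iff.mpr ⟨hpp.1, ?_, hpp.2.2⟩
      rw [List.isChain_iff_forall_rel_of_append_cons_cons]
      intro c d l₁ l₂ e
      refine .inl ⟨List.isChain_iff_forall_rel_of_append_cons_cons.mp hpp.2.1 e, ?_⟩
      rintro ⟨⟩
      exact hu ⟨p, hp, l₁, l₂, e⟩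
    have h1 := h0.insert_path (p := [x, t]) (a := x)
      (isPath_iff.mpr ⟨by simp, by simp [liftArcs], by simpa using hxt⟩) rfl
      ⟨t, by simp⟩ (by
        intro q hq w hw hwq
        have := hW q hq w hwq
        grind)
    exact ⟨_, h1.mono (by rw [Set.union_singleton]) subset_rfl⟩

theorem HasRouting.of_liftArcs {V : Type*} {A : Set (V × V)} {W X T : Set V} {u v x t : V}
    (hA : ∀ a ∈ A, a.1 ∈ W ∧ a.2 ∈ W) (hT : T ⊆ W) (hX : X ⊆ W) (huv : (u, v) ∈ A)
    (hx : x ∉ W) (ht : t ∉ W) (hxt : x ≠ t)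
    (h : HasRouting (liftArcs A u v x t) (X ∪ {x}) (T ∪ {t})) : HasRouting A X T := by
  obtain ⟨R, hR⟩ := h
  have harc : ∀ c d, (c, d) ∈ liftArcs A u v x t → c ≠ x → d ≠ t → (c, d) ∈ A := by
    rintro c d (h | h | h | h) hc hd
    · exact h.1
    all_goals simp_all
  have hsink : ∀ a, (t, a) ∉ liftArcs A u v x t := by
    rintro a (h | h | h | h)
    · exact ht (hA _ h.1).1
    all_goals simp only [Prod.mk.injEq, Set.mem_singleton_iff] at h; grind
  have hpred : ∀ a, (a, t) ∈ liftArcs A u v x t → a = u ∨ a = x := by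
    rintro a (h | h | h | h)
    · exact absurd (hA _ h.1).2 ht
    all_goals simp only [Prod.mk.injEq, Set.mem_singleton_iff] at h; grind
  have hsucc : ∀ a, (x, a) ∈ liftArcs A u v x t → a = v ∨ a = t := by
    rintro a (h | h | h | h)
    · exact absurd (hA _ h.1).1 hx
    all_goals simp only [Prod.mk.injEq, Set.mem_singleton_iff] at h; grind
  obtain ⟨P, hP, hPx⟩ := hR.2.1 x (.inr rfl)
  obtain ⟨P', rfl⟩ := List.head?_eq_some_iff.mp hPx
  have h0 : IsRouting A {p ∈ R | x ∉ p ∧ t ∉ p}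
      {y | ∃ p ∈ R, x ∉ p ∧ t ∉ p ∧ p.head? = some y} T := by
    refine ⟨?_, ?_, ?_, ?_⟩
    · rintro q ⟨hq, hqx, hqt⟩
      exact (hR.1 q hq).of_mem_imp fun c hc d hd hcd =>
        harc c d hcd (fun e => hqx (e ▸ hc)) (fun e => hqt (e ▸ hd))
    · rintro y ⟨p, hp, hpx, hpt, e⟩
      exact ⟨p, ⟨hp, hpx, hpt⟩, e⟩
    · rintro q ⟨hq, hqx, hqt⟩
      obtain ⟨y, hy | rfl, e⟩ := hR.2.2.1 q hq
      · exact ⟨y, hy, e⟩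
      · exact absurd (List.mem_of_getLast? e) hqt
    · rintro q ⟨hq, -⟩ r ⟨hr, -⟩
      exact hR.2.2.2 q hq r hr
  have hhead : ∀ y ∈ X, ∃ p ∈ R, x ∉ p ∧ p.head? = some y := by
    intro y hy
    obtain ⟨q, hq, e⟩ := hR.2.1 y (.inl hy)
    refine ⟨q, hq, fun hxq => ?_, e⟩
    rcases hR.2.2.2 q hq _ hP with rfl | hd
    · simp only [List.head?_cons, Option.some.injEq] at e
      exact hx (e ▸ hX hy)
    · exact hd x hxq (by simp)
  by_cases hQ : ∃ y ∈ X, ∃ q ∈ R, x ∉ q ∧ t ∈ q ∧ q.head? = some y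
  · obtain ⟨y, hy, q, hq, hqx, hqt, hqy⟩ := hQ
    obtain ⟨Q, rfl⟩ := (hR.1 q hq).eq_append_singleton hsink hqt
    have hyt : y ≠ t := fun e => ht (e ▸ hX hy)
    have hQne : Q ≠ [] := by
      rintro rfl
      simp only [List.nil_append, List.head?_cons, Option.some.injEq] at hqy
      exact hyt hqy.symm
    obtain ⟨Q, w, rfl⟩ := List.eq_nil_or_concat Q |>.resolve_left hQne
    have hqp := isPath_iff.mp (hR.1 _ hq)
    have hPp := isPath_iff.mp (hR.1 _ hP)
    simp only [List.concat_eq_append, List.append_assoc, List.singleton_append] at *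
    obtain ⟨hc1, hwt, -⟩ := List.isChain_append_cons_cons.mp hqp.2.1
    obtain rfl : w = u := (hpred w hwt).resolve_right (by rintro rfl; simp at hqx)
    have hdis : ∀ z ∈ Q ++ [w, t], z ∉ x :: P' :=
      (hR.2.2.2 _ hq _ hP).resolve_left (by rintro e; simp [e] at hqx)
    obtain ⟨z, hz, hlast⟩ := hR.2.2.1 _ hP
    have hzP : z ∈ x :: P' := List.mem_of_getLast? hlast
    have hzT : z ∈ T := hz.resolve_right (by rintro rfl; exact hdis z (by simp) hzP)
    cases P' with
    | nil =>
      simp only [List.getLast?_singleton, Option.some.injEq] at hlast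
      exact absurd (hT hzT) (hlast ▸ hx)
    | cons d P' =>
      obtain ⟨hxd, hc2⟩ := List.isChain_cons_cons.mp hPp.2.1
      obtain rfl : d = v := (hsucc d hxd).resolve_right
        (by rintro rfl; exact hdis d (by simp) (by simp))
      have hqnd := hqp.2.2
      have hPnd := hPp.2.2
      have hnew : IsPath A (Q ++ w :: d :: P') := by
        refine isPath_iff.mpr ⟨by simp, ?_, ?_⟩
        · refine List.isChain_append_cons_cons.mpr ⟨?_, huv, ?_⟩
          · refine hc1.imp_of_mem_imp fun c e hc he hce => harc c e hce ?_ ?_ <;> grind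
          · refine hc2.imp_of_mem_imp fun c e hc he hce => harc c e hce ?_ ?_ <;> grind
        · grind
      have h1 := h0.insert_path hnew (a := y) (by cases Q <;> simpa using hqy)
        ⟨z, hzT, by
          simpa [List.getLast?_append, List.getLast?_cons_cons] using hlast⟩ (by
          rintro r ⟨hr, hrx, hrt⟩ s hs hsr
          have h3 := (hR.2.2.2 _ hr _ hq).resolve_left (by rintro rfl; simp at hrt) s hsr
          have h4 := (hR.2.2.2 _ hr _ hP).resolve_left (by rintro rfl; simp at hrx) s hsr
          grind)
      refine ⟨_, h1.mono ?_ subset_rfl⟩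
      intro y' hy'
      obtain ⟨r, hr, hrx, e⟩ := hhead y' hy'
      by_cases hrt : t ∈ r
      · left
        rcases hR.2.2.2 _ hr _ hq with rfl | hd
        · exact Option.some.inj (e.symm.trans hqy)
        · exact absurd (by simp) (hd t hrt)
      · exact .inr ⟨r, hr, hrx, hrt, e⟩
  · refine ⟨_, h0.mono (fun y hy => ?_) subset_rfl⟩
    obtain ⟨q, hq, hqx, e⟩ := hhead y hy
    exact ⟨q, hq, hqx, fun hqt => hQ ⟨y, hy, q, hq, hqx, hqt, e⟩, e⟩

/-- Routings through a lifted cycle: `X ⊆ E` admits a routing to `T` in `D` iff `X ∪ {x}`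
admits a routing to `T ∪ {t}` in the lifting `D' = D^{(c)}_{(x,t)}`. -/
theorem lifting_routing_iff {α : Type*} (Vset : Set α) (hV : Vset.Finite)
    (A : Set (α × α)) (hA : ∀ a ∈ A, a.1 ∈ Vset ∧ a.2 ∈ Vset)
    (T E : Set α) (hT : T ⊆ Vset) (hE : E ⊆ Vset)
    (u v : α) (rest : List α) (hcyc : IsCycle A (u :: v :: rest))
    (x t : α) (hx : x ∉ Vset) (ht : t ∉ Vset) (hxt : x ≠ t) :
    ∀ X, X ⊆ E →
      (HasRouting A X T ↔ HasRouting (liftArcs A u v x t) (X ∪ {x}) (T ∪ {t})) := by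
  intro X hX
  have huv : (u, v) ∈ A := (List.isChain_cons_cons.mp hcyc.1.2).1
  exact ⟨HasRouting.to_liftArcs hA hT hx ht hxt,
    HasRouting.of_liftArcs hA hT (hX.trans hE) huv hx ht hxt⟩
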